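/- arXiv:2307.12085 — 2 statements merged into one kernel-verified Lean document; each statement's English description precedes it below -/
import Mathlib

section
/- Let f : ℝ^d → ℝ be a bounded measurable function and let E ⊂ ℝ^d be an ellipsoid (an affine image of the closed unit ball under an invertible affine map) with surface area S. Then for every y ∈ ℝ^d, |∫_E f(v) dv − ∫_E f(y+v) dv| ≤ C·‖f‖_∞·‖y‖·S, where C is a constant depending only on d. -/
open MeasureTheory

local notation "EE" n => EuclideanSpace ℝ (Fin (n + 1))

lemma cube_contDiff (n : ℕ) (i : Fin (n+1)) (e : ℝ) (he : e ≠ 0) :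
    ContDiff ℝ 1 (fun w : Fin n → ℝ =>
      ‖(WithLp.toLp 2 (Fin.insertNth i e w : Fin (n+1) → ℝ) : EE n)‖⁻¹ •
       (WithLp.toLp 2 (Fin.insertNth i e w : Fin (n+1) → ℝ) : EE n)) := by
  have h : ContDiff ℝ 1 (fun w : Fin n → ℝ =>
       (WithLp.toLp 2 (Fin.insertNth i e w : Fin (n+1) → ℝ) : EE n)) := by
    rw [contDiff_euclidean]
    intro k
    refine Fin.succAboveCases i ?_ (fun j => ?_) k
    · simp; fun_prop
    · simp; fun_prop
  have h0 : ∀ w : Fin n → ℝ,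
       (WithLp.toLp 2 (Fin.insertNth i e w : Fin (n+1) → ℝ) : EE n) ≠ 0 := by
    intro w hw
    have := congrArg (fun v : EE n => v i) hw
    simp at this
    exact he this
  exact ((h.norm ℝ h0).inv (fun w => norm_ne_zero_iff.2 (h0 w))).smul h

lemma sphere_subset (n : ℕ) : (Metric.sphere (0 : EE n) 1) ⊆
    ⋃ i : Fin (n+1), ⋃ b : Bool, (fun w : Fin n → ℝ =>
      ‖(WithLp.toLp 2 (Fin.insertNth i (if b then 1 else -1) w : Fin (n+1) → ℝ) : EE n)‖⁻¹ •
       (WithLp.toLp 2 (Fin.insertNth i (if b then 1 else -1) w : Fin (n+1) → ℝ) : EE n)) ''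
        Metric.closedBall 0 1 := by
  intro x hx
  have hx1 : ‖x‖ = 1 := by simpa using hx
  obtain ⟨i, hi⟩ := Finite.exists_max (fun i => |x i|)
  have hpos : 0 < |x i| := by
    rw [abs_pos]
    intro h0
    have : x = 0 := by
      ext j
      have := hi j
      rw [h0] at this
      simpa using this
    rw [this] at hx1
    simp at hx1
  simp only [Set.mem_iUnion]
  refine ⟨i, decide (0 < x i), fun j => x (i.succAbove j) / |x i|, ?_, ?_⟩
  · rw [mem_closedBall_zero_iff, pi_norm_le_iff_of_nonneg zero_le_one]
    intro j
    rw [Real.norm_eq_abs, abs_div, abs_abs, div_le_one hpos]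
    exact hi _
  · have key : (WithLp.toLp 2 (Fin.insertNth i (if decide (0 < x i) then 1 else -1)
        (fun j => x (i.succAbove j) / |x i|) : Fin (n+1) → ℝ) : EE n) = |x i|⁻¹ • x := by
      ext k
      refine Fin.succAboveCases i ?_ (fun j => ?_) k
      · simp only [Fin.insertNth_apply_same, PiLp.smul_apply, smul_eq_mul]
        by_cases h : 0 < x i
        · simp only [h, decide_true, if_true, abs_of_pos h]
          field_simp
        · have h' : x i < 0 := lt_of_le_of_ne (not_lt.1 h) (abs_pos.1 hpos)
          simp only [h, decide_false, abs_of_neg h']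
          have := h'.ne
          simp
          field_simp
      · simp only [Fin.insertNth_apply_succAbove, PiLp.smul_apply, smul_eq_mul]
        rw [div_eq_inv_mul]
    simp only [key]
    rw [norm_smul, hx1, smul_smul]
    simp [hpos.ne']

lemma frontier_finite (n : ℕ) (L : (EE n) ≃ᵃ[ℝ] (EE n)) :
    μH[(n : ℝ)] (L '' Metric.sphere 0 1) < ⊤ := by
  have hL : ContDiff ℝ 1 L := by
    have : (L : (EE n) → (EE n)) = fun x => LinearMap.toContinuousLinearMap
        (L.linear : (EE n) →ₗ[ℝ] (EE n)) x + L 0 := by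
      ext1 x
      have := L.map_vadd 0 x
      simpa using this
    rw [this]
    fun_prop
  refine lt_of_le_of_lt (measure_mono (Set.image_mono (sphere_subset n))) ?_
  rw [Set.image_iUnion]
  refine (measure_iUnion_le _).trans_lt ?_
  rw [tsum_fintype, ENNReal.sum_lt_top]
  intro i _
  rw [Set.image_iUnion]
  refine (measure_iUnion_le _).trans_lt ?_
  rw [tsum_fintype, ENNReal.sum_lt_top]
  intro b _
  rw [Set.image_image]
  have hc := hL.comp (cube_contDiff n i (if b then 1 else -1) (by split_ifs <;> norm_num))
  obtain ⟨K, hK⟩ := hc.contDiffOn.exists_lipschitzOnWith one_ne_zero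
    (convex_closedBall (0 : Fin n → ℝ) 1) (isCompact_closedBall _ _)
  refine (hK.hausdorffMeasure_image_le (Nat.cast_nonneg n)).trans_lt ?_
  have hv := hausdorffMeasure_pi_real (ι := Fin n)
  rw [Fintype.card_fin] at hv
  rw [hv]
  refine ENNReal.mul_lt_top ?_ (isCompact_closedBall _ _).measure_lt_top
  exact ENNReal.rpow_lt_top_of_nonneg (Nat.cast_nonneg n) ENNReal.coe_ne_top

lemma shift_vol (n : ℕ) (K : Set (EE n)) (hK : IsCompact K) (hc : Convex ℝ K) (y : EE n) :
    volume {x | x ∈ K ∧ x - y ∉ K} ≤ ENNReal.ofReal ‖y‖ * μH[(n : ℝ)] (frontier K) := by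
  by_cases hy : y = 0
  · subst hy
    simp
  have hy0 : 0 < ‖y‖ := norm_pos_iff.2 hy
  obtain ⟨b, hb⟩ : ∃ b : OrthonormalBasis (Fin (n+1)) ℝ (EE n), b 0 = ‖y‖⁻¹ • y := by
    obtain ⟨b, hb⟩ := Orthonormal.exists_orthonormalBasis_extension_of_card_eq (𝕜 := ℝ)
      (E := EE n) (ι := Fin (n+1)) (by simp) (v := fun _ => ‖y‖⁻¹ • y) (s := {0}) (by
        refine ⟨fun i => ?_, fun i j hij => absurd (Subsingleton.elim i j) hij⟩
        simp [norm_smul, hy0.ne'])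
    exact ⟨b, hb 0 rfl⟩
  have hyb : y = ‖y‖ • b 0 := by rw [hb, smul_smul, mul_inv_cancel₀ hy0.ne', one_smul]
  let ψ : ℝ × (Fin n → ℝ) → EE n := fun p =>
    b.repr.symm (WithLp.toLp 2 ((MeasurableEquiv.piFinSuccAbove (fun _ => ℝ) 0).symm p))
  have hψ : MeasurePreserving ψ volume volume :=
    (b.measurePreserving_repr_symm.comp (PiLp.volume_preserving_toLp (Fin (n+1)))).comp
      ((volume_preserving_piFinSuccAbove (fun _ : Fin (n+1) => ℝ) 0).symm)
  let P : (EE n) → (Fin n → ℝ) := fun x j => b.repr x j.succ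
  have hP : LipschitzWith 1 P := by
    refine LipschitzWith.of_dist_le_mul fun x z => ?_
    rw [NNReal.coe_one, one_mul, dist_pi_le_iff dist_nonneg]
    intro j
    have h1 : dist (b.repr x) (b.repr z) = dist x z := b.repr.dist_map x z
    rw [← h1]
    rw [dist_eq_norm, dist_eq_norm]
    exact PiLp.norm_apply_le (b.repr x - b.repr z) j.succ
  have hψr : ∀ s w, b.repr (ψ (s, w)) = WithLp.toLp 2 (Fin.cons s w : Fin (n+1) → ℝ) := by
    intro s w
    simp only [ψ, LinearIsometryEquiv.apply_symm_apply]
    congr 1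
    exact Fin.insertNth_zero' s w
  have hPψ : ∀ s w, P (ψ (s, w)) = w := by
    intro s w
    ext j
    simp only [P, hψr]
    simp
  have hψadd : ∀ s t w, ψ (s + t, w) = ψ (s, w) + t • b 0 := by
    intro s t w
    apply b.repr.injective
    rw [map_add, hψr, hψr, map_smul, b.repr_self]
    ext k
    refine Fin.cases ?_ (fun j => ?_) k <;> simp
  have hline : ∀ s w, ψ (s, w) = ψ (0, w) + s • b 0 := by
    intro s w
    rw [← hψadd, zero_add]
  have hS : MeasurableSet {x | x ∈ K ∧ x - y ∉ K} := by
    refine hK.measurableSet.inter ?_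
    exact (hK.measurableSet.preimage (measurable_id.sub_const y)).compl
  have hF : IsCompact (frontier K) := hK.of_isClosed_subset isClosed_frontier hK.isClosed.frontier_subset
  have hPF : MeasurableSet (P '' frontier K) := (hF.image hP.continuous).measurableSet
  rw [← hψ.measure_preimage hS.nullMeasurableSet, Measure.volume_eq_prod,
    Measure.prod_apply_symm (hψ.measurable hS)]
  have hslice : ∀ w, volume ((fun s : ℝ => (s, w)) ⁻¹' (ψ ⁻¹' {x | x ∈ K ∧ x - y ∉ K})) ≤
      (P '' frontier K).indicator (fun _ => ENNReal.ofReal ‖y‖) w := by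
    intro w
    let T : Set ℝ := {s | ψ (s, w) ∈ K}
    have hcont : Continuous (fun s : ℝ => ψ (s, w)) := by
      have : (fun s : ℝ => ψ (s, w)) = fun s => ψ (0, w) + s • b 0 := funext fun s => hline s w
      rw [this]
      fun_prop
    have hTcl : IsClosed T := hK.isClosed.preimage hcont
    have hTne : T.Nonempty → w ∈ P '' frontier K ∧ ∃ a ∈ T, ∀ s ∈ T, a ≤ s := by
      intro hne
      have hbd : BddBelow T := by
        obtain ⟨R, hR⟩ := hK.isBounded.exists_norm_le
        refine ⟨-R, fun s hs => ?_⟩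
        have h1 := hR _ hs
        have h2 : ‖b.repr (ψ (s, w))‖ = ‖ψ (s, w)‖ := b.repr.norm_map _
        have h3 := PiLp.norm_apply_le (b.repr (ψ (s, w))) 0
        rw [h2] at h3
        rw [hψr] at h3
        simp at h3
        have := (abs_le.1 (h3.trans h1)).1
        exact this
      have hmem := hTcl.csInf_mem hne hbd
      have hlb : ∀ s ∈ T, sInf T ≤ s := fun s hs => csInf_le hbd hs
      refine ⟨⟨ψ (sInf T, w), ⟨subset_closure hmem, fun hint => ?_⟩, hPψ _ _⟩, sInf T, hmem, hlb⟩
      have hnb : ∀ᶠ s in nhds (sInf T), ψ (s, w) ∈ K :=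
        hcont.continuousAt.eventually (mem_interior_iff_mem_nhds.1 hint)
      obtain ⟨ε, hε, hball⟩ := Metric.eventually_nhds_iff.1 hnb
      have : sInf T - ε / 2 ∈ T := hball (by
        rw [Real.dist_eq, sub_sub_cancel_left, abs_neg, abs_of_pos (half_pos hε)]; linarith)
      have := hlb _ this
      linarith
    by_cases hne : T.Nonempty
    · obtain ⟨hw, a, ha, hle⟩ := hTne hne
      rw [Set.indicator_of_mem hw]
      calc _ ≤ volume (Set.Icc a (a + ‖y‖)) := by
            apply measure_mono
            rintro s ⟨hs1, hs2⟩
            refine ⟨hle s hs1, ?_⟩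
            by_contra! hlt
            apply hs2
            have e1 : ψ (s, w) - y = ψ (s - ‖y‖, w) := by
              have := hψadd (s - ‖y‖) ‖y‖ w
              rw [sub_add_cancel, ← hyb] at this
              rw [this, add_sub_cancel_right]
            rw [e1]
            have hTc : Convex ℝ T := by
              have : T = (AffineMap.lineMap (ψ (0, w)) (ψ (0, w) + b 0) : ℝ →ᵃ[ℝ] EE n) ⁻¹' K := by
                ext s
                simp only [T, Set.mem_ofPred_eq, Set.mem_preimage, hline s w]
                simp [AffineMap.lineMap_apply, add_comm]
              rw [this]
              exact hc.affine_preimage _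
            exact hTc.ordConnected.out ha hs1 ⟨by linarith, by linarith⟩
        _ = _ := by rw [Real.volume_Icc]; congr 1; ring
    · have : ((fun s : ℝ => (s, w)) ⁻¹' (ψ ⁻¹' {x | x ∈ K ∧ x - y ∉ K})) = ∅ := by
        ext s
        simp only [Set.mem_empty_iff_false, iff_false]
        rintro ⟨hs, -⟩
        exact hne ⟨s, hs⟩
      rw [this]
      simp
  refine (lintegral_mono hslice).trans ?_
  rw [lintegral_indicator_const hPF]
  gcongr
  have hv := hausdorffMeasure_pi_real (ι := Fin n)
  rw [Fintype.card_fin] at hv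
  rw [← hv]
  refine (hP.hausdorffMeasure_image_le (Nat.cast_nonneg n) _).trans ?_
  simp

theorem stmt5 (d : ℕ) :
    ∃ C : ℝ, 0 < C ∧
      ∀ f : EuclideanSpace ℝ (Fin d) → ℝ, Measurable f →
        ∀ M : ℝ, (∀ x, |f x| ≤ M) →
          ∀ (L : EuclideanSpace ℝ (Fin d) ≃ᵃ[ℝ] EuclideanSpace ℝ (Fin d))
            (E : Set (EuclideanSpace ℝ (Fin d))), E = L '' Metric.closedBall 0 1 →
            ∀ y : EuclideanSpace ℝ (Fin d),
              |(∫ v in E, f v) - ∫ v in E, f (y + v)| ≤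
                C * M * ‖y‖ * (μH[(d : ℝ) - 1] (frontier E)).toReal := by
  refine ⟨2, two_pos, ?_⟩
  intro f hf M hM L E hE y
  rcases d with _ | n
  · have : y = 0 := Subsingleton.elim _ _
    subst this
    simp
  have hcast : ((n + 1 : ℕ) : ℝ) - 1 = n := by push_cast; ring
  rw [hcast]
  have hLc : Continuous L := L.continuous_of_finiteDimensional
  have hfr : frontier E = L '' Metric.sphere 0 1 := by
    have := (AffineEquiv.toContinuousAffineEquiv L).toHomeomorph.image_frontier
      (Metric.closedBall 0 1)
    rw [frontier_closedBall _ one_ne_zero] at this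
    rw [hE]
    exact this.symm
  have hfin : μH[(n : ℝ)] (frontier E) < ⊤ := by rw [hfr]; exact frontier_finite n L
  have hK : IsCompact E := by rw [hE]; exact (isCompact_closedBall _ _).image hLc
  have hc : Convex ℝ E := by
    rw [hE]; exact (convex_closedBall _ _).affine_image (L : (EE n) →ᵃ[ℝ] (EE n))
  set S := (μH[(n : ℝ)] (frontier E)).toReal with hSdef
  have hM0 : 0 ≤ M := (abs_nonneg _).trans (hM 0)
  have hvol : ∀ z : EE n, volume.real {x | x ∈ E ∧ x - z ∉ E} ≤ ‖z‖ * S := by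
    intro z
    have := ENNReal.toReal_mono (ENNReal.mul_ne_top ENNReal.ofReal_ne_top hfin.ne)
      (shift_vol n E hK hc z)
    rwa [ENNReal.toReal_mul, ENNReal.toReal_ofReal (norm_nonneg z)] at this
  set F : Set (EE n) := {x | x - y ∈ E} with hFdef
  have hFpre : (fun x => y + x) ⁻¹' F = E := by
    ext x; simp [F]
  have hFm : MeasurableSet F := hK.measurableSet.preimage (measurable_id.sub_const y)
  have hmp := measurePreserving_add_left (volume : Measure (EE n)) y
  have hFvol : volume F = volume E := by
    rw [← hmp.measure_preimage hFm.nullMeasurableSet, hFpre]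
  have hint : (∫ v in E, f (y + v)) = ∫ v in F, f v := by
    rw [← hmp.setIntegral_preimage_emb (measurableEmbedding_addLeft y) f F, hFpre]
  have hio : ∀ A : Set (EE n), volume A < ⊤ → IntegrableOn f A := by
    intro A hA
    exact Measure.integrableOn_of_bounded hA.ne hf.aestronglyMeasurable
      (M := M) (Filter.Eventually.of_forall hM)
  have hEt : volume E < ⊤ := hK.measure_lt_top
  have hFt : volume F < ⊤ := hFvol ▸ hEt
  rw [hint, ← integral_inter_add_sdiff hFm (hio E hEt),
    ← integral_inter_add_sdiff hK.measurableSet (hio F hFt), Set.inter_comm F E,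
    add_sub_add_left_eq_sub]
  have h1 : |∫ v in E \ F, f v| ≤ M * (‖y‖ * S) := by
    refine (norm_setIntegral_le_of_norm_le_const (f := f) (C := M)
      ((measure_mono Set.sdiff_subset).trans_lt hEt) (fun x _ => hM x)).trans ?_
    gcongr
    exact hvol y
  have h2 : |∫ v in F \ E, f v| ≤ M * (‖y‖ * S) := by
    refine (norm_setIntegral_le_of_norm_le_const (f := f) (C := M)
      ((measure_mono Set.sdiff_subset).trans_lt hFt) (fun x _ => hM x)).trans ?_
    gcongr
    have e : (fun x => y + x) ⁻¹' (F \ E) = {x | x ∈ E ∧ x - (-y) ∉ E} := by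
      ext x; simp [F, add_comm]
    have := hvol (-y)
    rw [← e, norm_neg] at this
    rwa [measureReal_def, hmp.measure_preimage (hFm.diff hK.measurableSet).nullMeasurableSet]
      at this
  calc _ ≤ |∫ v in E \ F, f v| + |∫ v in F \ E, f v| := abs_sub _ _
    _ ≤ _ := by linarith
end

section
/- The measure μ defined on H = ℝ^m ⋊ (ℝ_{>0} × Δ) (with multiplication (v₁,t₁,q₁)·(v₂,t₂,q₂) = (v₁ + t₁^{(m+1)/m} v₂ q₁^{−1}, t₁t₂, q₁q₂)) by ∫ f dμ = ∑_{q∈Δ} ∫_0^∞ ∫_{ℝ^m} f(v,t,q) dv·t^{−(m+2)} dt is left invariant: for every (v₀,t₀,q₀) ∈ H and every integrable f, ∫ f((v₀,t₀,q₀)·h) dμ(h) = ∫ f(h) dμ(h). -/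
open MeasureTheory

noncomputable instance deltaMeasurableSpace (m : ℕ)
    (Δ : Subgroup (Matrix.SpecialLinearGroup (Fin m) ℝ)) : MeasurableSpace ↥Δ := ⊤

/-- The measure `∑_{q∈Δ} ∫_0^∞ ∫_{ℝ^m} … dv t^{-(m+2)} dt` on `H ≅ ℝ^m ⋊ (ℝ_{>0} × Δ)`. -/
noncomputable def haarH (m : ℕ) (Δ : Subgroup (Matrix.SpecialLinearGroup (Fin m) ℝ)) :
    Measure ((Fin m → ℝ) × ℝ × ↥Δ) :=
  (volume : Measure (Fin m → ℝ)).prod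
    ((((volume : Measure ℝ).restrict (Set.Ioi (0 : ℝ))).withDensity
        fun t => ENNReal.ofReal (t ^ (-((m : ℝ) + 2)))).prod
      (Measure.count : Measure ↥Δ))

lemma aux_t (m : ℕ) (t₀ : ℝ) (ht₀ : 0 < t₀) :
    Measure.map (fun t : ℝ => t₀ * t)
      (((volume : Measure ℝ).restrict (Set.Ioi (0 : ℝ))).withDensity
        fun t => ENNReal.ofReal (t ^ (-((m : ℝ) + 2)))) =
    ENNReal.ofReal (t₀ ^ (m + 1)) •
      (((volume : Measure ℝ).restrict (Set.Ioi (0 : ℝ))).withDensity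
        fun t => ENNReal.ofReal (t ^ (-((m : ℝ) + 2)))) := by
  have hmul : Measurable (fun t : ℝ => t₀ * t) := measurable_const_mul t₀
  have hφ : Measurable (fun t : ℝ => ENNReal.ofReal (t ^ (-((m : ℝ) + 2)))) := by fun_prop
  ext A hA
  have key : ∀ B : Set ℝ, MeasurableSet B →
      (((volume : Measure ℝ).restrict (Set.Ioi (0 : ℝ))).withDensity
        fun t => ENNReal.ofReal (t ^ (-((m : ℝ) + 2)))) B =
      ∫⁻ t, (B ∩ Set.Ioi 0).indicator (fun t => ENNReal.ofReal (t ^ (-((m : ℝ) + 2)))) t := by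
    intro B hB
    rw [withDensity_apply _ hB, Measure.restrict_restrict hB,
      lintegral_indicator (hB.inter measurableSet_Ioi)]
  rw [Measure.map_apply hmul hA, key _ (hmul hA), Measure.smul_apply, key _ hA]
  set G := (A ∩ Set.Ioi 0).indicator (fun t : ℝ => ENNReal.ofReal (t ^ (-((m : ℝ) + 2)))) with hG
  have hGm : Measurable G := hφ.indicator (hA.inter measurableSet_Ioi)
  have h1 : ∀ t : ℝ, (((fun t : ℝ => t₀ * t) ⁻¹' A) ∩ Set.Ioi 0).indicator
      (fun t : ℝ => ENNReal.ofReal (t ^ (-((m : ℝ) + 2)))) t =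
      ENNReal.ofReal (t₀ ^ (m + 2)) * G (t₀ * t) := by
    intro t
    by_cases h : t ∈ ((fun t : ℝ => t₀ * t) ⁻¹' A) ∩ Set.Ioi 0
    · have h' : t₀ * t ∈ A ∩ Set.Ioi 0 := ⟨h.1, mul_pos ht₀ h.2⟩
      have ht : 0 < t := h.2
      rw [hG, Set.indicator_of_mem h, Set.indicator_of_mem h', ← ENNReal.ofReal_mul (by positivity),
        Real.mul_rpow ht₀.le ht.le, ← mul_assoc, ← Real.rpow_natCast, ← Real.rpow_add ht₀]
      simp
    · have h' : t₀ * t ∉ A ∩ Set.Ioi 0 := fun h2 => h ⟨h2.1, by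
        have := h2.2
        exact (mul_pos_iff_of_pos_left ht₀).1 this⟩
      rw [hG, Set.indicator_of_notMem h, Set.indicator_of_notMem h', mul_zero]
  simp_rw [h1]
  have hGc : Measurable (fun t => G (t₀ * t)) := hGm.comp hmul
  rw [lintegral_const_mul _ hGc, ← lintegral_map hGm hmul,
    Real.map_volume_mul_left ht₀.ne', lintegral_smul_measure, smul_eq_mul, smul_eq_mul,
    ← mul_assoc, ← ENNReal.ofReal_mul (by positivity), abs_of_pos (by positivity)]
  congr 2
  field_simp
  ring

lemma aux_v (m : ℕ) (hm : 2 ≤ m) (v₀ : Fin m → ℝ) (t₀ : ℝ) (ht₀ : 0 < t₀)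
    (q : Matrix (Fin m) (Fin m) ℝ) (hq : q.det = 1) :
    Measure.map (fun v : Fin m → ℝ => v₀ + t₀ ^ (((m : ℝ) + 1) / m) • Matrix.vecMul v q) volume =
    ENNReal.ofReal ((t₀ ^ (m + 1))⁻¹) • (volume : Measure (Fin m → ℝ)) := by
  set c := t₀ ^ (((m : ℝ) + 1) / m) with hc
  have hcm : c ^ m = t₀ ^ (m + 1) := by
    rw [hc, ← Real.rpow_natCast, ← Real.rpow_mul ht₀.le, ← Real.rpow_natCast]
    congr 1
    have : (m : ℝ) ≠ 0 := by positivity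
    push_cast
    field_simp
  have hdet : LinearMap.det (Matrix.toLin' (c • q.transpose)) = t₀ ^ (m + 1) := by
    rw [LinearMap.det_toLin', Matrix.det_smul, Matrix.det_transpose, hq]
    simp [hcm]
  have hfun : (fun v : Fin m → ℝ => v₀ + c • Matrix.vecMul v q) =
      (fun v => v₀ + v) ∘ (Matrix.toLin' (c • q.transpose)) := by
    ext v i
    simp [Matrix.mulVec_transpose]
  have hL : Measurable (Matrix.toLin' (c • q.transpose)) :=
    (LinearMap.continuous_of_finiteDimensional _).measurable
  rw [hfun, ← Measure.map_map (measurable_const_add v₀) hL,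
    Real.map_linearMap_volume_pi_eq_smul_volume_pi (by rw [hdet]; positivity),
    Measure.map_smul, map_add_left_eq_self, hdet, abs_of_pos (by positivity)]

theorem stmt13 (m : ℕ) (hm : 2 ≤ m)
    (Δ : Subgroup (Matrix.SpecialLinearGroup (Fin m) ℝ)) [Countable ↥Δ]
    (v₀ : Fin m → ℝ) (t₀ : ℝ) (ht₀ : 0 < t₀) (q₀ : ↥Δ)
    (f : (Fin m → ℝ) × ℝ × ↥Δ → ℝ) (hf : Integrable f (haarH m Δ)) :
    ∫ h, f (v₀ + t₀ ^ (((m : ℝ) + 1) / m) •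
          Matrix.vecMul h.1 (((q₀⁻¹ : ↥Δ) : Matrix.SpecialLinearGroup (Fin m) ℝ) :
            Matrix (Fin m) (Fin m) ℝ),
        t₀ * h.2.1, q₀ * h.2.2) ∂(haarH m Δ) =
      ∫ h, f h ∂(haarH m Δ) := by
  have hΔ : DiscreteMeasurableSpace ↥Δ := ⟨fun _ => trivial⟩
  set A : (Fin m → ℝ) → (Fin m → ℝ) := fun v => v₀ + t₀ ^ (((m : ℝ) + 1) / m) •
    Matrix.vecMul v (((q₀⁻¹ : ↥Δ) : Matrix.SpecialLinearGroup (Fin m) ℝ) :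
            Matrix (Fin m) (Fin m) ℝ) with hA
  have hAm : Measurable A := by
    apply Continuous.measurable
    fun_prop
  have hT : Measurable (fun t : ℝ => t₀ * t) := measurable_const_mul t₀
  have hQ : Measurable (fun q : ↥Δ => q₀ * q) := measurable_of_countable _
  have hcount : Measure.map (fun q : ↥Δ => q₀ * q) Measure.count = Measure.count := by
    ext s hs
    rw [Measure.map_apply hQ hs, Measure.count_apply (hQ hs), Measure.count_apply hs,
      ← (mul_right_injective q₀).encard_image,
      Set.image_preimage_eq _ (mul_left_surjective q₀)]
  have hmap : Measure.map (Prod.map A (Prod.map (fun t : ℝ => t₀ * t) (fun q : ↥Δ => q₀ * q)))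
      (haarH m Δ) = haarH m Δ := by
    unfold haarH
    rw [← Measure.map_prod_map _ _ hAm (hT.prodMap hQ), ← Measure.map_prod_map _ _ hT hQ,
      hcount, aux_t m t₀ ht₀, hA, aux_v m hm v₀ t₀ ht₀ _ (Matrix.SpecialLinearGroup.det_coe _),
      Measure.prod_smul_left, Measure.prod_smul_left, Measure.prod_smul_right, smul_smul,
      ← ENNReal.ofReal_mul (by positivity), inv_mul_cancel₀ (by positivity)]
    simp
  have hm2 := hAm.prodMap (hT.prodMap hQ)
  have := integral_map (μ := haarH m Δ) (f := f) hm2.aemeasurable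
    (by rw [hmap]; exact hf.aestronglyMeasurable)
  rw [hmap] at this
  exact this.symm
end
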